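/- Let n ∈ ℕ, n ≥ 1, let S ⊆ ℝⁿ, let a^{jk} : ℝⁿ → ℝ (1 ≤ j,k ≤ n) be smooth with a^{jk} = a^{kj}, let φ : ℝⁿ → ℝ be smooth, and let μ₀ > 0 satisfy condition (d1): Σ_{j,k=1}^n { Σ_{j',k'=1}^n [ 2a^{jk'}(a^{j'k}φ_{x_{j'}})_{x_{k'}} − (∂_{x_{k'}}a^{jk}) a^{j'k'}φ_{x_{j'}} ] } ξ_j ξ_k ≥ μ₀ Σ_{j,k=1}^n a^{jk} ξ_j ξ_k for all x ∈ S and ξ ∈ ℝⁿ. Let T > 0, λ > 0, c₀ ∈ ℝ, c₁ ∈ ℝ, define ℓ(t,x) := λ[ φ(x) − c₁(t − T/2)² ], Ψ := ℓ_{tt} + Σ_{j,k=1}^n (a^{jk}ℓ_{x_j})_{x_k} − c₀λ, and c^{jk} := (a^{jk}ℓ_t)_t + Σ_{j',k'=1}^n [ 2a^{jk'}(a^{j'k}ℓ_{x_{j'}})_{x_{k'}} − (a^{jk}a^{j'k'}ℓ_{x_{j'}})_{x_{k'}} ] + Ψ a^{jk}. Then for all t ∈ ℝ, x ∈ S and ξ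 ∈ ℝⁿ: Σ_{j,k=1}^n c^{jk} ξ_j ξ_k ≥ λ (μ₀ − 4c₁ − c₀) Σ_{j,k=1}^n a^{jk} ξ_j ξ_k. -/

import Mathlib

open scoped BigOperators

/-- Partial derivative in the `j`-th coordinate of `ℝⁿ`. -/
noncomputable def pd {n : ℕ} (j : Fin n) (f : (Fin n → ℝ) → ℝ) : (Fin n → ℝ) → ℝ :=
  fun x => fderiv ℝ f x (Pi.single j 1)

/-- Partial derivative in time (first component of `ℝ × ℝⁿ`). -/
noncomputable def pt {n : ℕ} (f : ℝ × (Fin n → ℝ) → ℝ) : ℝ × (Fin n → ℝ) → ℝ :=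
  fun p => fderiv ℝ f p (1, 0)

/-- Partial derivative in the `j`-th spatial coordinate of `ℝ × ℝⁿ`. -/
noncomputable def px {n : ℕ} (j : Fin n) (f : ℝ × (Fin n → ℝ) → ℝ) : ℝ × (Fin n → ℝ) → ℝ :=
  fun p => fderiv ℝ f p (0, Pi.single j 1)

theorem px_comp_snd {n : ℕ} (k : Fin n) (g : (Fin n → ℝ) → ℝ) (hg : Differentiable ℝ g)
    (p : ℝ × (Fin n → ℝ)) : px k (fun q => g q.2) p = pd k g p.2 := by
  have h := ((hg p.2).hasFDerivAt).comp p (hasFDerivAt_snd (𝕜 := ℝ) (E := ℝ) (F := Fin n → ℝ) (p := p))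
  have h2 : fderiv ℝ (fun q : ℝ × (Fin n → ℝ) => g q.2) p = _ := h.fderiv
  simp [px, pd, h2]

theorem pt_eq_of_hasDerivAt {n : ℕ} (f : ℝ × (Fin n → ℝ) → ℝ) (p : ℝ × (Fin n → ℝ)) (d : ℝ)
    (hf : DifferentiableAt ℝ f p) (hd : HasDerivAt (fun s => f (s, p.2)) d p.1) : pt f p = d := by
  have hin : HasDerivAt (fun s : ℝ => (s, p.2)) ((1 : ℝ), (0 : Fin n → ℝ)) p.1 :=
    (hasDerivAt_id p.1).prodMk (hasDerivAt_const p.1 p.2)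
  have h := HasFDerivAt.comp_hasDerivAt (f := fun s : ℝ => (s, p.2)) p.1
    (l := f) (l' := fderiv ℝ f p) hf.hasFDerivAt hin
  exact h.unique hd

theorem px_eq_of_slice {n : ℕ} (k : Fin n) (f : ℝ × (Fin n → ℝ) → ℝ) (p : ℝ × (Fin n → ℝ))
    (hf : DifferentiableAt ℝ f p) : px k f p = pd k (fun y => f (p.1, y)) p.2 := by
  have hin : HasFDerivAt (fun y : Fin n → ℝ => (p.1, y))
      ((0 : (Fin n → ℝ) →L[ℝ] ℝ).prod (ContinuousLinearMap.id ℝ (Fin n → ℝ))) p.2 :=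
    (hasFDerivAt_const p.1 p.2).prodMk (hasFDerivAt_id p.2)
  have h := HasFDerivAt.comp (f := fun y : Fin n → ℝ => (p.1, y))
    (g := f) (g' := fderiv ℝ f p) p.2 hf.hasFDerivAt hin
  have h2 : fderiv ℝ (fun y : Fin n → ℝ => f (p.1, y)) p.2 = _ := h.fderiv
  simp [px, pd, h2]

theorem pd_mul' {n : ℕ} (k : Fin n) (f g : (Fin n → ℝ) → ℝ) (x : Fin n → ℝ)
    (hf : Differentiable ℝ f) (hg : Differentiable ℝ g) :
    pd k (fun y => f y * g y) x = pd k f x * g x + f x * pd k g x := by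
  simp only [pd]
  rw [fderiv_fun_mul (hf x) (hg x)]
  simp
  ring

theorem pd_const_mul' {n : ℕ} (k : Fin n) (r : ℝ) (f : (Fin n → ℝ) → ℝ) (x : Fin n → ℝ)
    (hf : Differentiable ℝ f) : pd k (fun y => r * f y) x = r * pd k f x := by
  simp only [pd]
  rw [fderiv_const_mul (hf x)]
  simp

/-- Inequality (vivj): under condition (d1), the quadratic form `Σ c^{jk} ξ_j ξ_k`
associated with the Carleman weight `ℓ(t,x) = λ(φ(x) − c₁(t − T/2)²)` is bounded below by
`λ(μ₀ − 4c₁ − c₀) Σ a^{jk} ξ_j ξ_k`. -/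
theorem stmt8 (n : ℕ) (hn : 1 ≤ n) (S : Set (Fin n → ℝ))
    (a : Fin n → Fin n → (Fin n → ℝ) → ℝ)
    (ha : ∀ j k, ContDiff ℝ (⊤ : ℕ∞) (a j k))
    (hasym : ∀ j k, a j k = a k j)
    (φ : (Fin n → ℝ) → ℝ) (hφ : ContDiff ℝ (⊤ : ℕ∞) φ)
    (μ₀ : ℝ) (hμ₀ : 0 < μ₀)
    (hd1 : ∀ x ∈ S, ∀ ξ : Fin n → ℝ,
      μ₀ * (∑ j, ∑ k, a j k x * ξ j * ξ k) ≤
        ∑ j, ∑ k,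
          (∑ j', ∑ k',
            (2 * a j k' x * pd k' (fun y => a j' k y * pd j' φ y) x
              - pd k' (a j k) x * a j' k' x * pd j' φ x)) * ξ j * ξ k)
    (T lam c₀ c₁ : ℝ) (hT : 0 < T) (hlam : 0 < lam)
    (ℓ : ℝ × (Fin n → ℝ) → ℝ)
    (hℓ : ℓ = fun p => lam * (φ p.2 - c₁ * (p.1 - T/2) ^ 2))
    (Ψ : ℝ × (Fin n → ℝ) → ℝ)
    (hΨ : Ψ = fun p =>
      pt (pt ℓ) p + (∑ j, ∑ k, px k (fun q => a j k q.2 * px j ℓ q) p) - c₀ * lam)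
    (c : Fin n → Fin n → ℝ × (Fin n → ℝ) → ℝ)
    (hc : ∀ j k, c j k = fun p =>
      pt (fun q => a j k q.2 * pt ℓ q) p
      + (∑ j', ∑ k',
          (2 * a j k' p.2 * px k' (fun q => a j' k q.2 * px j' ℓ q) p
            - px k' (fun q => a j k q.2 * a j' k' q.2 * px j' ℓ q) p))
      + Ψ p * a j k p.2) :
    ∀ t : ℝ, ∀ x ∈ S, ∀ ξ : Fin n → ℝ,
      lam * (μ₀ - 4 * c₁ - c₀) * (∑ j, ∑ k, a j k x * ξ j * ξ k) ≤
        ∑ j, ∑ k, c j k (t, x) * ξ j * ξ k := by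
  have hda : ∀ j k, Differentiable ℝ (a j k) := fun j k => (ha j k).differentiable (by simp)
  have hdφ : Differentiable ℝ φ := hφ.differentiable (by simp)
  have hdpφ : ∀ j, Differentiable ℝ (pd j φ) := by
    intro j
    have h1 : ContDiff ℝ 1 (fderiv ℝ φ) := hφ.fderiv_right (by norm_cast)
    have h2 : Differentiable ℝ (fderiv ℝ φ) := h1.differentiable (by simp)
    intro x
    exact (h2 x).clm_apply (differentiableAt_const _)
  have hdℓ : Differentiable ℝ ℓ := by
    rw [hℓ]; fun_prop
  have hptℓ : pt ℓ = fun q => -2 * lam * c₁ * (q.1 - T/2) := by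
    funext q
    apply pt_eq_of_hasDerivAt _ _ _ (hdℓ q)
    rw [hℓ]
    have h := (((((hasDerivAt_id q.1).sub_const (T/2)).pow 2).const_mul c₁).const_sub
      (φ q.2)).const_mul lam
    refine h.congr_deriv ?_
    simp; ring
  have hpxℓ : ∀ j, px j ℓ = fun q => lam * pd j φ q.2 := by
    intro j
    funext q
    rw [px_eq_of_slice j ℓ q (hdℓ q), hℓ]
    simp only [pd]
    rw [fderiv_const_mul (by fun_prop), fderiv_sub_const]
    simp
  have hptt : ∀ p, pt (pt ℓ) p = -2 * lam * c₁ := by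
    intro p
    rw [hptℓ]
    apply pt_eq_of_hasDerivAt _ _ _ (by fun_prop)
    have h := ((hasDerivAt_id p.1).sub_const (T/2)).const_mul (-2 * lam * c₁)
    refine h.congr_deriv ?_
    simp
  have hat : ∀ j k p, pt (fun q => a j k q.2 * pt ℓ q) p = -2 * lam * c₁ * a j k p.2 := by
    intro j k p
    rw [hptℓ]
    have := hda j k
    apply pt_eq_of_hasDerivAt _ _ _ (by fun_prop)
    have h := (((hasDerivAt_id p.1).sub_const (T/2)).const_mul (-2 * lam * c₁)).const_mul
      (a j k p.2)
    refine h.congr_deriv ?_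
    simp; ring
  have hax : ∀ j k i p, px i (fun q => a j k q.2 * px j ℓ q) p
      = lam * pd i (fun y => a j k y * pd j φ y) p.2 := by
    intro j k i p
    rw [hpxℓ]
    have h1 := hda j k
    have h2 := hdpφ j
    rw [← pd_const_mul' _ _ _ _ (by fun_prop), ← px_comp_snd _ _ (by fun_prop)]
    congr 1
    funext q
    ring
  have haax : ∀ j k j' k' p, px k' (fun q => a j k q.2 * a j' k' q.2 * px j' ℓ q) p
      = lam * (pd k' (a j k) p.2 * a j' k' p.2 * pd j' φ p.2
        + a j k p.2 * pd k' (fun y => a j' k' y * pd j' φ y) p.2) := by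
    intro j k j' k' p
    rw [hpxℓ]
    have h1 := hda j k
    have h3 := hda j' k'
    have h2 := hdpφ j'
    have h4 := pd_mul' k' (a j k) (fun y => a j' k' y * pd j' φ y) p.2 h1 (by fun_prop)
    rw [mul_assoc (pd k' (a j k) p.2), ← h4,
      ← pd_const_mul' _ _ _ _ (by fun_prop), ← px_comp_snd _ _ (by fun_prop)]
    congr 1
    funext q
    ring
  intro t x hx ξ
  have hcc : ∀ j k, c j k (t, x) = lam * (∑ j', ∑ k',
            (2 * a j k' x * pd k' (fun y => a j' k y * pd j' φ y) x
              - pd k' (a j k) x * a j' k' x * pd j' φ x))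
      + lam * (- 4 * c₁ - c₀) * a j k x := by
    intro j k
    rw [hc, hΨ]
    simp only [hat, hptt, hax, haax]
    have e : (∑ j', ∑ k', (2 * a j k' x * (lam * pd k' (fun y => a j' k y * pd j' φ y) x)
        - lam * (pd k' (a j k) x * a j' k' x * pd j' φ x
          + a j k x * pd k' (fun y => a j' k' y * pd j' φ y) x)))
        = lam * (∑ j', ∑ k',
            (2 * a j k' x * pd k' (fun y => a j' k y * pd j' φ y) x
              - pd k' (a j k) x * a j' k' x * pd j' φ x))
          - (∑ j', ∑ k', lam * pd k' (fun y => a j' k' y * pd j' φ y) x) * a j k x := by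
      simp only [Finset.mul_sum, Finset.sum_mul, ← Finset.sum_sub_distrib]
      refine Finset.sum_congr rfl fun j' _ => Finset.sum_congr rfl fun k' _ => ?_
      ring
    rw [e]
    ring
  have key := mul_le_mul_of_nonneg_left (hd1 x hx ξ) hlam.le
  have e2 : ∑ j, ∑ k, c j k (t, x) * ξ j * ξ k = lam * (∑ j, ∑ k,
          (∑ j', ∑ k',
            (2 * a j k' x * pd k' (fun y => a j' k y * pd j' φ y) x
              - pd k' (a j k) x * a j' k' x * pd j' φ x)) * ξ j * ξ k)
      + lam * (- 4 * c₁ - c₀) * (∑ j, ∑ k, a j k x * ξ j * ξ k) := by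
    rw [Finset.mul_sum, Finset.mul_sum, ← Finset.sum_add_distrib]
    refine Finset.sum_congr rfl fun j _ => ?_
    rw [Finset.mul_sum, Finset.mul_sum, ← Finset.sum_add_distrib]
    refine Finset.sum_congr rfl fun k _ => ?_
    rw [hcc]
    ring
  rw [e2]
  linarith
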